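/- arXiv:1804.08102 — 3 statements merged into one kernel-verified Lean document; each statement's English description precedes it below -/
import Mathlib

section
/- Let σ be a finite positive Borel measure on the open unit disk 𝔻 which is absolutely continuous with respect to planar Lebesgue measure and doubling, i.e. there exists a constant C₀ such that σ(B(z,2r)) ≤ C₀·σ(B(z,r)) for all z ∈ 𝔻 and r > 0, where B(z,r) = {w ∈ 𝔻 : |w − z| < r}. Then σ is a 𝒟-Carleson measure. -/
open MeasureTheory Metric Set
open scoped ENNReal Real

noncomputable section

/-- `μ` is a Carleson measure for the Dirichlet space: `∫_𝔻 |f|² dμ ≤ C ‖f‖²_𝒟`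
for all analytic `f` on the unit disk, where
`‖f‖²_𝒟 = |f(0)|² + (1/π) ∫_𝔻 |f'|² dA`. -/
def DCarleson (μ : Measure ℂ) : Prop :=
  ∃ C : ℝ, ∀ f : ℂ → ℂ, DifferentiableOn ℂ f (Metric.ball 0 1) →
    ∫⁻ z in Metric.ball (0:ℂ) 1, (‖f z‖₊ : ℝ≥0∞) ^ 2 ∂μ ≤
      ENNReal.ofReal C * ((‖f 0‖₊ : ℝ≥0∞) ^ 2 +
        (ENNReal.ofReal Real.pi)⁻¹ *
          ∫⁻ z in Metric.ball (0:ℂ) 1, (‖deriv f z‖₊ : ℝ≥0∞) ^ 2)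

/-- Change of variables for the homothety of ratio `t` centred at `z`. -/
theorem lintegral_homothety (F : ℂ → ℝ≥0∞) (z : ℂ) {t : ℝ} (ht : 0 < t) :
    ∫⁻ w, F (z + t * (w - z)) = ENNReal.ofReal (t ^ (-2 : ℝ)) * ∫⁻ w, F w := by
  have h1 : ∫⁻ w, F (z + t * (w - z)) = ∫⁻ w, F (z + t * w) :=
    lintegral_sub_right_eq_self (fun w => F (z + t * w)) z
  have h2 : ∫⁻ w, F w = ∫⁻ w, F (z + w) := (lintegral_add_left_eq_self F z).symm
  have h3 := Measure.map_addHaar_smul (volume : Measure ℂ) ht.ne'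
  have e : MeasurableEmbedding (fun w : ℂ => t • w) :=
    (Homeomorph.smulOfNeZero t ht.ne').measurableEmbedding
  have h4 : ∫⁻ w, F (z + t * w) = ∫⁻ w, F (z + w) ∂(Measure.map (t • ·) volume) := by
    rw [e.lintegral_map]; simp
  rw [h1, h2, h4, h3, lintegral_smul_measure]
  rw [Complex.finrank_real_complex, abs_of_pos (by positivity), Real.rpow_neg ht.le]
  simp

/-- The Cauchy-Schwarz inequality for lower integrals. -/
theorem sq_lintegral_mul_le {α : Type*} [MeasurableSpace α] (μ : Measure α) {f g : α → ℝ≥0∞}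
    (hf : AEMeasurable f μ) (hg : AEMeasurable g μ) :
    (∫⁻ x, f x * g x ∂μ) ^ 2 ≤ (∫⁻ x, f x ^ 2 ∂μ) * ∫⁻ x, g x ^ 2 ∂μ := by
  have h := ENNReal.lintegral_mul_le_Lp_mul_Lq μ Real.HolderConjugate.two_two hf hg
  have h2 := pow_le_pow_left' h 2
  refine h2.trans_eq ?_
  rw [mul_pow, ← ENNReal.rpow_natCast, ← ENNReal.rpow_natCast, ← ENNReal.rpow_mul,
    ← ENNReal.rpow_mul]
  norm_num

theorem lintegral_rpow_lt_top {s : ℝ} (hs : -1 < s) :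
    ∫⁻ t in Ioo (0 : ℝ) 1, ENNReal.ofReal (t ^ s) < ∞ := by
  have h := (intervalIntegral.intervalIntegrable_rpow' (a := 0) (b := 1) hs).1
  have h' : IntegrableOn (fun t : ℝ => t ^ s) (Ioo 0 1) := h.mono_set Ioo_subset_Ioc_self
  refine lt_of_le_of_lt (lintegral_mono fun t => ?_) h'.2
  exact Real.ofReal_le_enorm _

/-- The sub-mean value property on circles centred at the origin. -/
theorem enorm_mul_two_pi_le_lintegral_circle {h : ℂ → ℂ} {r : ℝ} (hr : 0 ≤ r) (hr1 : r < 1)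
    (hh : DifferentiableOn ℂ h (ball 0 1)) :
    ‖h 0‖ₑ * ENNReal.ofReal (2 * π) ≤
      ∫⁻ θ in Ioo (-π) π, ‖h (Complex.polarCoord.symm (r, θ))‖ₑ := by
  have hc : Real.circleAverage h 0 r = h 0 := by
    refine circleAverage_of_differentiable_on_off_countable countable_empty ?_ ?_
    · refine hh.continuousOn.mono (closedBall_subset_ball ?_)
      rwa [abs_of_nonneg hr]
    · intro z hz
      refine hh.differentiableAt (isOpen_ball.mem_nhds (ball_subset_ball ?_ hz.1))
      rw [abs_of_nonneg hr]; exact hr1.le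
  have hp : ∫ θ in (0 : ℝ)..2 * π, h (circleMap 0 r θ) = ∫ θ in (-π)..π, h (circleMap 0 r θ) := by
    have := ((periodic_circleMap 0 r).comp h).intervalIntegral_add_eq 0 (-π)
    simp only [zero_add] at this
    rw [show -π + 2 * π = π by ring] at this
    exact this
  have h1 : (2 * π) • h 0 = ∫ θ in Ioo (-π) π, h (Complex.polarCoord.symm (r, θ)) := by
    rw [← hc, Real.circleAverage_def, hp, smul_smul, mul_inv_cancel₀ (by positivity), one_smul,
      intervalIntegral.integral_of_le (by linarith [Real.pi_pos]), integral_Ioc_eq_integral_Ioo]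
    congr 1
    ext θ
    simp [circleMap, Complex.exp_mul_I]
  calc ‖h 0‖ₑ * ENNReal.ofReal (2 * π) = ‖(2 * π) • h 0‖ₑ := by
        rw [enorm_smul, mul_comm, Real.enorm_of_nonneg (by positivity)]
    _ ≤ _ := by rw [h1]; exact enorm_integral_le_lintegral_enorm _

/-- The sub-mean value property on the disk of radius `1 / 2`. -/
theorem enorm_le_lintegral_ball {h : ℂ → ℂ} (hh : DifferentiableOn ℂ h (ball 0 1)) :
    ‖h 0‖ₑ ≤ 4 * ∫⁻ w in ball (0 : ℂ) (1 / 2), ‖h w‖ₑ := by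
  set S : Set (ℝ × ℝ) := Ioo (1 / 4) (1 / 2) ×ˢ Ioo (-π) π with hS
  have hSm : MeasurableSet S := measurableSet_Ioo.prod measurableSet_Ioo
  have hmem : ∀ p ∈ S, Complex.polarCoord.symm p ∈ ball (0 : ℂ) (1 / 2) := by
    intro p hp
    rw [mem_ball_zero_iff, Complex.norm_polarCoord_symm, abs_of_pos (by linarith [hp.1.1])]
    exact hp.1.2
  have hm : AEMeasurable (fun p : ℝ × ℝ => ‖h (Complex.polarCoord.symm p)‖ₑ)
      (volume.restrict S) := by
    refine ContinuousOn.aemeasurable (ContinuousOn.enorm ?_) hSm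
    refine hh.continuousOn.comp ?_ fun p hp => ball_subset_ball (by norm_num) (hmem p hp)
    rw [show ⇑Complex.polarCoord.symm = _ from funext Complex.polarCoord_symm_apply]
    fun_prop
  have hprod : (volume.restrict S : Measure (ℝ × ℝ)) =
      (volume.restrict (Ioo (1 / 4) (1 / 2))).prod (volume.restrict (Ioo (-π) π)) := by
    rw [Measure.prod_restrict]; rfl
  have hlow : ENNReal.ofReal (1 / 4) * ∫⁻ p in S, ‖h (Complex.polarCoord.symm p)‖ₑ ≤
      ∫⁻ w in ball (0 : ℂ) (1 / 2), ‖h w‖ₑ := by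
    rw [← lintegral_indicator measurableSet_ball, ← Complex.lintegral_comp_polarCoord_symm,
      ← lintegral_const_mul' _ _ ENNReal.ofReal_ne_top]
    have hsub : S ⊆ polarCoord.target := by
      rintro p ⟨hp1, hp2⟩
      exact ⟨mem_Ioi.2 (by linarith [hp1.1]), hp2⟩
    refine le_trans ?_ (lintegral_mono_set hsub)
    refine setLIntegral_mono' hSm fun p hp => ?_
    rw [indicator_of_mem (hmem p hp), smul_eq_mul]
    gcongr
    exact hp.1.1.le
  have hcirc : ENNReal.ofReal (1 / 4) * (‖h 0‖ₑ * ENNReal.ofReal (2 * π)) ≤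
      ∫⁻ p in S, ‖h (Complex.polarCoord.symm p)‖ₑ := by
    rw [hprod, lintegral_prod _ (hprod ▸ hm)]
    calc ENNReal.ofReal (1 / 4) * (‖h 0‖ₑ * ENNReal.ofReal (2 * π))
        = ∫⁻ _ in Ioo (1 / 4 : ℝ) (1 / 2), ‖h 0‖ₑ * ENNReal.ofReal (2 * π) := by
          rw [setLIntegral_const, Real.volume_Ioo, mul_comm]; norm_num
      _ ≤ _ := setLIntegral_mono' measurableSet_Ioo fun r hr =>
          enorm_mul_two_pi_le_lintegral_circle (by linarith [hr.1]) (by linarith [hr.2]) hh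
  calc ‖h 0‖ₑ ≤ ENNReal.ofReal (4 * (1 / 4) * (1 / 4) * (2 * π)) * ‖h 0‖ₑ := by
        refine le_mul_of_one_le_left' ?_
        rw [ENNReal.one_le_ofReal]
        linarith [Real.pi_gt_three]
    _ = 4 * (ENNReal.ofReal (1 / 4) *
          (ENNReal.ofReal (1 / 4) * (‖h 0‖ₑ * ENNReal.ofReal (2 * π)))) := by
        rw [ENNReal.ofReal_mul (by positivity), ENNReal.ofReal_mul (by positivity),
          ENNReal.ofReal_mul (by positivity)]
        rw [show ENNReal.ofReal 4 = 4 by simp]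
        ring
    _ ≤ _ := by
        gcongr
        exact le_trans (by gcongr) hlow

/-- The difference of two values is bounded by the integral of the derivative along the segment. -/
theorem enorm_sub_le_lintegral_deriv {f : ℂ → ℂ} (hf : DifferentiableOn ℂ f (ball 0 1)) {z w : ℂ}
    (hz : z ∈ ball (0 : ℂ) 1) (hw : w ∈ ball (0 : ℂ) 1) :
    ‖f z - f w‖ₑ ≤ ‖w - z‖ₑ * ∫⁻ t in Ioo (0 : ℝ) 1, ‖deriv f (z + t * (w - z))‖ₑ := by
  have hmem : ∀ t ∈ Icc (0 : ℝ) 1, z + t * (w - z) ∈ ball (0 : ℂ) 1 := by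
    intro t ht
    have := (convex_ball (0 : ℂ) 1).add_smul_sub_mem hz hw ht
    simpa using this
  have hd : ∀ t ∈ uIcc (0 : ℝ) 1,
      HasDerivAt (fun t : ℝ => f (z + t * (w - z))) (deriv f (z + t * (w - z)) * (w - z)) t := by
    intro t ht
    rw [uIcc_of_le zero_le_one] at ht
    have h1 : HasDerivAt f (deriv f (z + t * (w - z))) (z + t * (w - z)) :=
      (hf.differentiableAt (isOpen_ball.mem_nhds (hmem t ht))).hasDerivAt
    have h2 : HasDerivAt (fun t : ℝ => z + t * (w - z)) (w - z) t := by
      have := ((Complex.ofRealCLM.hasDerivAt (x := t)).mul_const (w - z)).const_add z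
      simpa using this
    exact h1.comp t h2
  have hcont : ContinuousOn (fun t : ℝ => deriv f (z + t * (w - z)) * (w - z)) (uIcc 0 1) := by
    rw [uIcc_of_le zero_le_one]
    refine ContinuousOn.mul ?_ continuousOn_const
    exact (hf.deriv isOpen_ball).continuousOn.comp (by fun_prop) hmem
  have h := intervalIntegral.integral_eq_sub_of_hasDerivAt hd hcont.intervalIntegrable
  rw [intervalIntegral.integral_of_le zero_le_one, integral_Ioc_eq_integral_Ioo] at h
  have h' : f w - f z = ∫ t in Ioo (0 : ℝ) 1, deriv f (z + t * (w - z)) * (w - z) := by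
    rw [h]; simp
  rw [← enorm_neg, neg_sub, h']
  refine (enorm_integral_le_lintegral_enorm _).trans_eq ?_
  rw [← lintegral_const_mul' _ _ enorm_ne_top]
  simp_rw [enorm_mul, mul_comm]

/-- Reverse doubling forces polynomial decay of the measure of small balls. -/
theorem exists_measure_ball_le_rpow (τ : Measure ℂ) [IsFiniteMeasure τ] {q : ℝ} (hq : 0 < q)
    (hq1 : q < 1) (hτ : ∀ z ∈ ball (0 : ℂ) 1, ∀ r : ℝ, 0 < r → r < 1 / 2 →
      τ (ball z r) ≤ ENNReal.ofReal q * τ (ball z (4 * r))) :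
    ∃ δ : ℝ, 0 < δ ∧ ∃ K : ℝ, ∀ z ∈ ball (0 : ℂ) 1, ∀ t : ℝ, 0 < t →
      τ (ball z (2 * t)) ≤ ENNReal.ofReal (K * t ^ δ) := by
  set M : ℝ := τ.real univ with hM
  have hM0 : 0 ≤ M := measureReal_nonneg
  have hMτ : ENNReal.ofReal M = τ univ := ENNReal.ofReal_toReal (measure_ne_top _ _)
  have hiter : ∀ k : ℕ, ∀ z ∈ ball (0 : ℂ) 1,
      τ (ball z ((1 / 4) ^ k)) ≤ ENNReal.ofReal (q ^ k * M) := by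
    intro k
    induction k with
    | zero => intro z _; simpa [hMτ] using measure_mono (subset_univ _)
    | succ k ih =>
      intro z hz
      have hle : (1 / 4 : ℝ) ^ k ≤ 1 := pow_le_one₀ (by norm_num) (by norm_num)
      refine (hτ z hz _ (by positivity) (by rw [pow_succ]; linarith)).trans ?_
      rw [pow_succ, show (4 : ℝ) * ((1 / 4) ^ k * (1 / 4)) = (1 / 4) ^ k by ring,
        show q ^ (k + 1) * M = q * (q ^ k * M) by ring, ENNReal.ofReal_mul hq.le]
      gcongr
      exact ih z hz
  refine ⟨Real.logb (1 / 4) q, Real.logb_pos_of_base_lt_one (by norm_num) (by norm_num) hq hq1, ?_⟩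
  set δ := Real.logb (1 / 4) q with hδdef
  have hδ : 0 < δ := Real.logb_pos_of_base_lt_one (by norm_num) (by norm_num) hq hq1
  have hδq : (1 / 4 : ℝ) ^ δ = q := Real.rpow_logb (by norm_num) (by norm_num) hq
  refine ⟨M / q * 2 ^ δ, fun z hz t ht => ?_⟩
  rw [mul_assoc, ← Real.mul_rpow (by norm_num) ht.le]
  have hs : 0 < 2 * t := by positivity
  generalize 2 * t = s at hs
  rcases le_or_gt s 1 with hs1 | hs1
  · obtain ⟨k, hk, hk'⟩ := exists_nat_pow_near_of_lt_one hs hs1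
      (show (0 : ℝ) < 1 / 4 by norm_num) (by norm_num)
    refine (measure_mono (ball_subset_ball hk')).trans ((hiter k z hz).trans ?_)
    refine ENNReal.ofReal_le_ofReal ?_
    have h1 : q ^ (k + 1) ≤ s ^ δ := by
      rw [← hδq, ← Real.rpow_natCast, ← Real.rpow_mul (by norm_num), mul_comm,
        Real.rpow_mul (by norm_num), Real.rpow_natCast]
      exact Real.rpow_le_rpow (by positivity) hk.le hδ.le
    calc q ^ k * M = M / q * q ^ (k + 1) := by rw [pow_succ]; field_simp
      _ ≤ _ := by gcongr
  · refine (measure_mono (subset_univ _)).trans ?_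
    rw [← hMτ]
    gcongr
    have h1 : 1 ≤ s ^ δ := Real.one_le_rpow hs1.le hδ.le
    have h2 : M ≤ M / q := (le_div_iff₀ hq).2 (by nlinarith)
    nlinarith [div_nonneg hM0 hq.le]

/-- A doubling measure on the disk satisfies a reverse doubling condition. -/
theorem exists_reverse_doubling (σ : Measure ℂ) [IsFiniteMeasure σ] (C₀ : ℝ)
    (hdoubling : ∀ z ∈ ball (0:ℂ) 1, ∀ r : ℝ, 0 < r →
      σ (ball z (2 * r) ∩ ball 0 1) ≤ ENNReal.ofReal C₀ * σ (ball z r ∩ ball 0 1)) :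
    ∃ q : ℝ, 0 < q ∧ q < 1 ∧ ∀ z ∈ ball (0 : ℂ) 1, ∀ r : ℝ, 0 < r → r < 1 / 2 →
      σ.restrict (ball 0 1) (ball z r) ≤
        ENNReal.ofReal q * σ.restrict (ball 0 1) (ball z (4 * r)) := by
  set C : ℝ := max C₀ 1
  have hC1 : 1 ≤ C := le_max_right _ _
  have hC : 0 < C := by linarith
  set τ := σ.restrict (ball 0 1)
  have hd : ∀ z ∈ ball (0:ℂ) 1, ∀ r : ℝ, 0 < r → τ.real (ball z (2 * r)) ≤ C * τ.real (ball z r) := by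
    intro z hz r hr
    have h := hdoubling z hz r hr
    rw [← Measure.restrict_apply measurableSet_ball, ← Measure.restrict_apply measurableSet_ball] at h
    have h' : τ (ball z (2 * r)) ≤ ENNReal.ofReal C * τ (ball z r) :=
      h.trans (by gcongr; exact le_max_left _ _)
    have := ENNReal.toReal_mono (by finiteness) h'
    rwa [ENNReal.toReal_mul, ENNReal.toReal_ofReal hC.le] at this
  refine ⟨C ^ 2 / (1 + C ^ 2), by positivity, (div_lt_one (by positivity)).2 (by linarith), ?_⟩
  intro z hz r hr hr2
  obtain ⟨y, hy, hyz⟩ : ∃ y ∈ ball (0 : ℂ) 1, dist y z = 2 * r := by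
    rw [mem_ball_zero_iff] at hz
    obtain ⟨e, he, hze⟩ : ∃ e : ℂ, ‖e‖ = 1 ∧ z = ‖z‖ * e := by
      by_cases h0 : z = 0
      · exact ⟨1, by simp, by simp [h0]⟩
      · have : (‖z‖ : ℂ) ≠ 0 := by simpa using h0
        exact ⟨z / ‖z‖, by simp [h0], by field_simp⟩
    refine ⟨((‖z‖ - 2 * r : ℝ) : ℂ) * e, ?_, ?_⟩
    · rw [mem_ball_zero_iff, norm_mul, he, mul_one, Complex.norm_real, Real.norm_eq_abs, abs_lt]
      constructor <;> linarith [norm_nonneg z]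
    · rw [dist_eq_norm]
      nth_rewrite 2 [hze]
      rw [← sub_mul, norm_mul, he, mul_one, ← Complex.ofReal_sub, Complex.norm_real,
        Real.norm_eq_abs, sub_sub_cancel_left, abs_neg, abs_of_pos (by positivity)]
  have h1 : τ.real (ball z r) ≤ C * (C * τ.real (ball y r)) := by
    calc τ.real (ball z r) ≤ τ.real (ball y (2 * (2 * r))) :=
          measureReal_mono (ball_subset_ball' (by rw [dist_comm, hyz]; linarith))
      _ ≤ C * τ.real (ball y (2 * r)) := hd y hy _ (by positivity)
      _ ≤ _ := by gcongr; exact hd y hy r hr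
  have h2 : τ.real (ball z r) + τ.real (ball y r) ≤ τ.real (ball z (4 * r)) := by
    rw [← measureReal_union (ball_disjoint_ball (by rw [dist_comm, hyz]; linarith))
      measurableSet_ball]
    refine measureReal_mono (union_subset (ball_subset_ball (by linarith)) ?_)
    exact ball_subset_ball' (by rw [hyz]; linarith)
  have h3 : τ.real (ball z r) ≤ C ^ 2 / (1 + C ^ 2) * τ.real (ball z (4 * r)) := by
    rw [div_mul_eq_mul_div, le_div_iff₀ (by positivity)]
    nlinarith [sq_nonneg C]
  rw [← ENNReal.ofReal_toReal (measure_ne_top τ (ball z r)),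
    ← ENNReal.ofReal_toReal (measure_ne_top τ (ball z (4 * r))),
    ← ENNReal.ofReal_mul (by positivity)]
  exact ENNReal.ofReal_le_ofReal h3

/-- A Poincaré inequality for measures with polynomial decay on balls. -/
theorem exists_lintegral_lintegral_sub_sq_le (τ : Measure ℂ) [IsFiniteMeasure τ]
    (hτ : ∀ᵐ z ∂τ, z ∈ ball (0 : ℂ) 1) {δ K : ℝ} (hδ : 0 < δ)
    (hgrowth : ∀ z ∈ ball (0 : ℂ) 1, ∀ t : ℝ, 0 < t →
      τ (ball z (2 * t)) ≤ ENNReal.ofReal (K * t ^ δ)) :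
    ∃ C : ℝ≥0∞, C ≠ ∞ ∧ ∀ f : ℂ → ℂ, DifferentiableOn ℂ f (ball 0 1) →
      ∫⁻ z, (∫⁻ w in ball (0 : ℂ) (1 / 2), ‖f z - f w‖ₑ ^ 2) ∂τ ≤
        C * ∫⁻ u in ball (0 : ℂ) 1, ‖deriv f u‖ₑ ^ 2 := by
  have hexp : -1 < -1 + δ / 2 := by linarith
  set A : ℝ≥0∞ := ∫⁻ t in Ioo (0 : ℝ) 1, ENNReal.ofReal (t ^ (-1 + δ / 2)) with hA
  have hAtop : A ≠ ∞ := (lintegral_rpow_lt_top hexp).ne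
  refine ⟨4 * A * (ENNReal.ofReal K * A), by finiteness, fun f hf => ?_⟩
  set G : ℂ → ℝ≥0∞ := (ball (0 : ℂ) 1).indicator fun u => ‖deriv f u‖ₑ ^ 2 with hG
  have hGm : Measurable G := by
    refine Measurable.indicator ?_ measurableSet_ball
    exact (measurable_deriv f).enorm.pow_const 2
  have hGint : ∫⁻ u, G u = ∫⁻ u in ball (0 : ℂ) 1, ‖deriv f u‖ₑ ^ 2 :=
    lintegral_indicator measurableSet_ball _
  set b : ℝ := (1 - δ / 2) / 2 with hb
  set H : ℂ → ℝ → ℂ → ℝ≥0∞ := fun z t u => if dist u z < 2 * t then G u else 0 with hH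
  have hHm : Measurable fun p : (ℂ × ℝ) × ℂ => H p.1.1 p.1.2 p.2 := by
    refine Measurable.ite (measurableSet_lt (by fun_prop) (by fun_prop)) ?_ measurable_const
    exact hGm.comp measurable_snd
  have hpt : ∀ z ∈ ball (0 : ℂ) 1, ∀ w ∈ ball (0 : ℂ) (1 / 2), ‖f z - f w‖ₑ ^ 2 ≤
      4 * A * ∫⁻ t in Ioo (0 : ℝ) 1,
        ENNReal.ofReal (t ^ (1 - δ / 2)) * G (z + t * (w - z)) := by
    intro z hz w hw
    have hw1 : w ∈ ball (0 : ℂ) 1 := ball_subset_ball (by norm_num) hw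
    have hwz : ‖w - z‖ₑ ≤ 2 := by
      rw [← ofReal_norm, show (2 : ℝ≥0∞) = ENNReal.ofReal 2 by simp]
      apply ENNReal.ofReal_le_ofReal
      rw [mem_ball_zero_iff] at hz hw1
      linarith [norm_sub_le w z]
    have hline := enorm_sub_le_lintegral_deriv hf hz hw1
    have hdm : Measurable fun t : ℝ => ‖deriv f (z + t * (w - z))‖ₑ :=
      ((measurable_deriv f).comp (by fun_prop)).enorm
    have hsplit : ∫⁻ t in Ioo (0 : ℝ) 1, ‖deriv f (z + t * (w - z))‖ₑ =
        ∫⁻ t in Ioo (0 : ℝ) 1, ENNReal.ofReal (t ^ (-b)) *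
          (ENNReal.ofReal (t ^ b) * ‖deriv f (z + t * (w - z))‖ₑ) := by
      refine setLIntegral_congr_fun measurableSet_Ioo fun t ht => ?_
      rw [← mul_assoc, ← ENNReal.ofReal_mul (Real.rpow_nonneg ht.1.le _), ← Real.rpow_add ht.1]
      simp
    have hCS := sq_lintegral_mul_le (volume.restrict (Ioo (0 : ℝ) 1))
      (f := fun t => ENNReal.ofReal (t ^ (-b)))
      (g := fun t => ENNReal.ofReal (t ^ b) * ‖deriv f (z + t * (w - z))‖ₑ)
      (by fun_prop) (by fun_prop)
    have e1 : ∫⁻ t in Ioo (0 : ℝ) 1, ENNReal.ofReal (t ^ (-b)) ^ 2 = A := by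
      refine setLIntegral_congr_fun measurableSet_Ioo fun t ht => ?_
      rw [← ENNReal.ofReal_pow (Real.rpow_nonneg ht.1.le _), ← Real.rpow_mul_natCast ht.1.le]
      congr 2
      push_cast
      ring
    have e2 : ∫⁻ t in Ioo (0 : ℝ) 1,
          (ENNReal.ofReal (t ^ b) * ‖deriv f (z + t * (w - z))‖ₑ) ^ 2 =
        ∫⁻ t in Ioo (0 : ℝ) 1,
          ENNReal.ofReal (t ^ (1 - δ / 2)) * G (z + t * (w - z)) := by
      refine setLIntegral_congr_fun measurableSet_Ioo fun t ht => ?_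
      have hmem : z + t * (w - z) ∈ ball (0 : ℂ) 1 := by
        simpa using (convex_ball (0 : ℂ) 1).add_smul_sub_mem hz hw1 ⟨ht.1.le, ht.2.le⟩
      rw [hG, indicator_of_mem hmem, mul_pow, ← ENNReal.ofReal_pow (Real.rpow_nonneg ht.1.le _),
        ← Real.rpow_mul_natCast ht.1.le]
      congr 3
      push_cast
      ring
    rw [e1, e2, ← hsplit] at hCS
    calc ‖f z - f w‖ₑ ^ 2
        ≤ (2 * ∫⁻ t in Ioo (0 : ℝ) 1, ‖deriv f (z + t * (w - z))‖ₑ) ^ 2 := by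
          gcongr
          exact hline.trans (by gcongr)
      _ = 4 * (∫⁻ t in Ioo (0 : ℝ) 1, ‖deriv f (z + t * (w - z))‖ₑ) ^ 2 := by
          rw [mul_pow]; norm_num
      _ ≤ _ := by rw [mul_assoc]; gcongr
  have hinner : ∀ z ∈ ball (0 : ℂ) 1, ∫⁻ w in ball (0 : ℂ) (1 / 2), ‖f z - f w‖ₑ ^ 2 ≤
      4 * A * ∫⁻ t in Ioo (0 : ℝ) 1,
        ENNReal.ofReal (t ^ (-1 - δ / 2)) * ∫⁻ u, H z t u := by
    intro z hz
    calc ∫⁻ w in ball (0 : ℂ) (1 / 2), ‖f z - f w‖ₑ ^ 2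
        ≤ ∫⁻ w in ball (0 : ℂ) (1 / 2), 4 * A * ∫⁻ t in Ioo (0 : ℝ) 1,
            ENNReal.ofReal (t ^ (1 - δ / 2)) * G (z + t * (w - z)) :=
          setLIntegral_mono' measurableSet_ball (hpt z hz)
      _ = 4 * A * ∫⁻ t in Ioo (0 : ℝ) 1, ∫⁻ w in ball (0 : ℂ) (1 / 2),
            ENNReal.ofReal (t ^ (1 - δ / 2)) * G (z + t * (w - z)) := by
          rw [lintegral_const_mul' _ _ (by finiteness), lintegral_lintegral_swap]
          refine Measurable.aemeasurable ?_
          exact Measurable.mul (by fun_prop) (hGm.comp (by fun_prop))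
      _ ≤ _ := by
          gcongr 4 * A * ?_
          refine setLIntegral_mono' measurableSet_Ioo fun t ht => ?_
          rw [lintegral_const_mul' _ _ ENNReal.ofReal_ne_top]
          calc ENNReal.ofReal (t ^ (1 - δ / 2)) *
                ∫⁻ w in ball (0 : ℂ) (1 / 2), G (z + t * (w - z))
              ≤ ENNReal.ofReal (t ^ (1 - δ / 2)) * ∫⁻ w, H z t (z + t * (w - z)) := by
                refine mul_le_mul_right ?_ _
                refine (setLIntegral_mono' measurableSet_ball fun w hw => ?_).trans
                  (setLIntegral_le_lintegral (ball (0 : ℂ) (1 / 2)) _)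
                have hlt : dist (z + t * (w - z)) z < 2 * t := by
                  rw [dist_eq_norm, add_sub_cancel_left, norm_mul, Complex.norm_real,
                    Real.norm_of_nonneg ht.1.le, mul_comm]
                  rw [mem_ball_zero_iff] at hz hw
                  have := norm_sub_le w z
                  exact mul_lt_mul_of_pos_right (by linarith) ht.1
                simp only [hH, if_pos hlt, le_refl]
            _ = _ := by
                rw [lintegral_homothety (H z t) z ht.1, ← mul_assoc,
                  ← ENNReal.ofReal_mul (Real.rpow_nonneg ht.1.le _), ← Real.rpow_add ht.1]
                congr 3
                ring_nf
  calc ∫⁻ z, (∫⁻ w in ball (0 : ℂ) (1 / 2), ‖f z - f w‖ₑ ^ 2) ∂τ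
      ≤ ∫⁻ z, (4 * A * ∫⁻ t in Ioo (0 : ℝ) 1,
          ENNReal.ofReal (t ^ (-1 - δ / 2)) * ∫⁻ u, H z t u) ∂τ :=
        lintegral_mono_ae (hτ.mono hinner)
    _ = 4 * A * ∫⁻ t in Ioo (0 : ℝ) 1, ∫⁻ z,
          (ENNReal.ofReal (t ^ (-1 - δ / 2)) * ∫⁻ u, H z t u) ∂τ := by
        rw [lintegral_const_mul' _ _ (by finiteness), lintegral_lintegral_swap]
        refine Measurable.aemeasurable ?_
        exact Measurable.mul (by fun_prop) hHm.lintegral_prod_right'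
    _ ≤ 4 * A * ∫⁻ t in Ioo (0 : ℝ) 1, ENNReal.ofReal (t ^ (-1 + δ / 2)) *
          (ENNReal.ofReal K * ∫⁻ u, G u) := by
        gcongr 4 * A * ?_
        refine setLIntegral_mono' measurableSet_Ioo fun t ht => ?_
        rw [lintegral_const_mul' _ _ ENNReal.ofReal_ne_top, lintegral_lintegral_swap]
        swap
        · refine Measurable.aemeasurable ?_
          exact hHm.comp (f := fun p : ℂ × ℂ => ((p.1, t), p.2)) (by fun_prop)
        have hz : ∀ u, ∫⁻ z, H z t u ∂τ ≤ ENNReal.ofReal (t ^ δ) * (ENNReal.ofReal K * G u) := by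
          intro u
          by_cases hu : u ∈ ball (0 : ℂ) 1
          · have : ∫⁻ z, H z t u ∂τ = G u * τ (ball u (2 * t)) := by
              rw [← lintegral_indicator_const measurableSet_ball]
              refine lintegral_congr fun z => ?_
              simp only [hH, indicator, mem_ball, dist_comm]
            rw [this, mul_comm (G u), ← mul_assoc,
              ← ENNReal.ofReal_mul (Real.rpow_nonneg ht.1.le _), mul_comm _ K]
            gcongr
            exact hgrowth u hu t ht.1
          · have : G u = 0 := indicator_of_notMem hu _
            simp [hH, this]
        calc _ ≤ ENNReal.ofReal (t ^ (-1 - δ / 2)) *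
                ∫⁻ u, ENNReal.ofReal (t ^ δ) * (ENNReal.ofReal K * G u) := by
              exact mul_le_mul_right (lintegral_mono hz) _
          _ = _ := by
              rw [lintegral_const_mul' _ _ ENNReal.ofReal_ne_top,
                lintegral_const_mul' _ _ ENNReal.ofReal_ne_top, ← mul_assoc,
                ← ENNReal.ofReal_mul (Real.rpow_nonneg ht.1.le _), ← Real.rpow_add ht.1]
              congr 3
              ring_nf
    _ = _ := by
        rw [lintegral_mul_const _ (by fun_prop), hGint]
        ring

/-- Every finite doubling measure on the disk which is absolutely continuous with
respect to Lebesgue measure is a Carleson measure for the Dirichlet space. -/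
theorem doubling_DCarleson (σ : Measure ℂ) [IsFiniteMeasure σ] (habs : σ ≪ volume)
    (C₀ : ℝ)
    (hdoubling : ∀ z ∈ Metric.ball (0:ℂ) 1, ∀ r : ℝ, 0 < r →
      σ (Metric.ball z (2 * r) ∩ Metric.ball 0 1) ≤
        ENNReal.ofReal C₀ * σ (Metric.ball z r ∩ Metric.ball 0 1)) :
    DCarleson σ := by
  obtain ⟨q, hq, hq1, hrev⟩ := exists_reverse_doubling σ C₀ hdoubling
  obtain ⟨δ, hδ, K, hgrowth⟩ := exists_measure_ball_le_rpow _ hq hq1 hrev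
  obtain ⟨C, hC, hmain⟩ := exists_lintegral_lintegral_sub_sq_le (σ.restrict (ball 0 1))
    (ae_restrict_mem measurableSet_ball) hδ hgrowth
  have hpi : ENNReal.ofReal π ≠ 0 := by simpa using Real.pi_pos
  set D : ℝ≥0∞ := 2 * σ (ball 0 1) + 8 * C * ENNReal.ofReal π with hD
  have hDtop : D ≠ ∞ := by finiteness
  refine ⟨D.toReal, fun f hf => ?_⟩
  rw [ENNReal.ofReal_toReal hDtop]
  simp only [← enorm_eq_nnnorm]
  set E := ∫⁻ z in ball (0 : ℂ) 1, ‖deriv f z‖ₑ ^ 2 with hE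
  have hmean : ∀ z, ‖f z - f 0‖ₑ ^ 2 ≤
      4 * ∫⁻ w in ball (0 : ℂ) (1 / 2), ‖f z - f w‖ₑ ^ 2 := by
    intro z
    have h := enorm_le_lintegral_ball (h := fun w => (f z - f w) ^ 2)
      (((differentiableOn_const _).sub hf).pow 2)
    simpa only [enorm_pow] using h
  have hpt : ∀ z, ‖f z‖ₑ ^ 2 ≤ 2 * ‖f 0‖ₑ ^ 2 +
      8 * ∫⁻ w in ball (0 : ℂ) (1 / 2), ‖f z - f w‖ₑ ^ 2 := by
    intro z
    calc ‖f z‖ₑ ^ 2 = ‖f 0 + (f z - f 0)‖ₑ ^ 2 := by rw [add_sub_cancel]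
      _ ≤ (‖f 0‖ₑ + ‖f z - f 0‖ₑ) ^ 2 := by gcongr; exact enorm_add_le _ _
      _ ≤ 2 * (‖f 0‖ₑ ^ 2 + ‖f z - f 0‖ₑ ^ 2) := by
          have h := ENNReal.rpow_add_le_mul_rpow_add_rpow ‖f 0‖ₑ ‖f z - f 0‖ₑ one_le_two
          norm_num at h
          exact h
      _ ≤ 2 * (‖f 0‖ₑ ^ 2 + 4 * ∫⁻ w in ball (0 : ℂ) (1 / 2), ‖f z - f w‖ₑ ^ 2) := by
          gcongr; exact hmean z
      _ = _ := by ring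
  calc ∫⁻ z in ball (0 : ℂ) 1, ‖f z‖ₑ ^ 2 ∂σ
      ≤ ∫⁻ z in ball (0 : ℂ) 1, (2 * ‖f 0‖ₑ ^ 2 +
          8 * ∫⁻ w in ball (0 : ℂ) (1 / 2), ‖f z - f w‖ₑ ^ 2) ∂σ := lintegral_mono hpt
    _ = 2 * σ (ball 0 1) * ‖f 0‖ₑ ^ 2 + 8 * ∫⁻ z in ball (0 : ℂ) 1,
          (∫⁻ w in ball (0 : ℂ) (1 / 2), ‖f z - f w‖ₑ ^ 2) ∂σ := by
        rw [lintegral_add_left measurable_const, lintegral_const_mul' 8 _ (by finiteness),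
          setLIntegral_const]
        ring
    _ ≤ 2 * σ (ball 0 1) * ‖f 0‖ₑ ^ 2 + 8 * (C * E) := by gcongr; exact hmain f hf
    _ = 2 * σ (ball 0 1) * ‖f 0‖ₑ ^ 2 +
          8 * C * ENNReal.ofReal π * ((ENNReal.ofReal π)⁻¹ * E) := by
        rw [mul_assoc (8 * C), ← mul_assoc (ENNReal.ofReal π), ENNReal.mul_inv_cancel hpi ENNReal.ofReal_ne_top]
        ring
    _ ≤ D * ‖f 0‖ₑ ^ 2 + D * ((ENNReal.ofReal π)⁻¹ * E) := by
        gcongr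
        · exact le_self_add
        · exact le_add_self
    _ = _ := by rw [mul_add]
end
end

section
/- For every arc J ⊆ 𝕋 of the unit circle there exists an arc L ∈ D⁰ ∪ D^{1/3} such that J ⊆ L and |L| ≤ 6|J|, where |·| denotes arc length. -/
open MeasureTheory Metric Set
open scoped ENNReal Real

noncomputable section

/-- The arc `{e^{2πit} : t ∈ [θ, θ+ℓ)}` of the unit circle (normalized parametrization:
normalized length `ℓ = 1` gives the whole circle). -/
def arcSet (θ ℓ : ℝ) : Set ℂ :=
  {z : ℂ | ∃ t ∈ Set.Ico θ (θ + ℓ), z = Complex.exp (2 * Real.pi * Complex.I * t)}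

/-- The arc of the (possibly shifted) dyadic grid `D^β`:
`{e^{iθ} : θ ∈ [2πm/2^j + 2πβ, 2π(m+1)/2^j + 2πβ)}`, i.e. the arc of normalized length
`1/2^j` starting at normalized angle `m/2^j + β`.  The grids of the paper are `β = 0` and
`β = 1/3`. -/
def dyadicArc (β : ℝ) (j m : ℕ) : Set ℂ := arcSet ((m : ℝ) / 2 ^ j + β) (1 / 2 ^ j)

/-- Rotating the starting angle by a full number of turns does not change an arc. -/
theorem arcSet_add_int (θ ℓ : ℝ) (n : ℤ) : arcSet (θ + n) ℓ = arcSet θ ℓ := by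
  have key (t : ℝ) (k : ℤ) : Complex.exp (2 * Real.pi * Complex.I * t) =
      Complex.exp (2 * Real.pi * Complex.I * (t + k : ℝ)) :=
    Complex.exp_eq_exp_iff_exists_int.2 ⟨-k, by push_cast; ring⟩
  ext z
  constructor
  · rintro ⟨t, ⟨h₁, h₂⟩, rfl⟩
    refine ⟨t + (-n : ℤ), ⟨?_, ?_⟩, key t (-n)⟩ <;> push_cast <;> linarith
  · rintro ⟨t, ⟨h₁, h₂⟩, rfl⟩
    exact ⟨t + n, ⟨by linarith, by linarith⟩, key t n⟩

theorem arcSet_subset_arcSet {θ ℓ θ' ℓ' : ℝ} (h₁ : θ' ≤ θ) (h₂ : θ + ℓ ≤ θ' + ℓ') :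
    arcSet θ ℓ ⊆ arcSet θ' ℓ' := by
  rintro z ⟨t, ⟨ht₁, ht₂⟩, rfl⟩
  exact ⟨t, ⟨h₁.trans ht₁, ht₂.trans_le h₂⟩, rfl⟩

theorem arcSet_subset_arcSet_zero_one (θ ℓ : ℝ) : arcSet θ ℓ ⊆ arcSet 0 1 := by
  rintro z ⟨t, -, rfl⟩
  rw [← arcSet_add_int 0 1 ⌊t⌋, zero_add]
  exact ⟨t, ⟨Int.floor_le t, Int.lt_floor_add_one t⟩, rfl⟩

/-- Every integer index of a dyadic arc can be reduced to one in `[0, 2 ^ j)`. -/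
theorem exists_dyadicArc_eq (β : ℝ) (j : ℕ) (k : ℤ) :
    ∃ m : ℕ, m < 2 ^ j ∧ dyadicArc β j m = arcSet ((k : ℝ) / 2 ^ j + β) (1 / 2 ^ j) := by
  have hN : (0 : ℤ) < 2 ^ j := by positivity
  obtain ⟨m, hm⟩ := Int.eq_ofNat_of_zero_le (Int.emod_nonneg k hN.ne')
  have hlt := Int.emod_lt_of_pos k hN
  have hdiv := Int.emod_add_mul_ediv k (2 ^ j)
  rw [hm] at hlt hdiv
  refine ⟨m, by exact_mod_cast hlt, ?_⟩
  have hk : (k : ℝ) = m + 2 ^ j * (k / 2 ^ j : ℤ) := by exact_mod_cast hdiv.symm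
  have hangle : (k : ℝ) / 2 ^ j + β = (m / 2 ^ j + β) + (k / 2 ^ j : ℤ) := by
    rw [hk]
    field_simp
    ring
  rw [hangle, arcSet_add_int, dyadicArc]

/-- Two points of the grids `2⁻ʲ ℤ` and `2⁻ʲ ℤ + 1/3` are at least `2⁻ʲ / 3` apart. -/
theorem one_le_abs_three_mul_sub_two_pow (k : ℤ) (j : ℕ) :
    (1 : ℝ) ≤ |3 * (k : ℝ) - 2 ^ j| := by
  have hne : 3 * k - 2 ^ j ≠ 0 := by
    intro h
    have hdvd : (3 : ℤ) ∣ 2 ^ j := ⟨k, by linarith⟩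
    have := Int.prime_three.dvd_of_dvd_pow hdvd
    norm_num at this
  exact_mod_cast Int.one_le_abs hne

theorem arcSet_subset_floor {θ ℓ β : ℝ} {j : ℕ}
    (h : (θ + ℓ - β) * 2 ^ j ≤ ⌊(θ - β) * 2 ^ j⌋ + 1) :
    ∃ m : ℕ, m < 2 ^ j ∧ arcSet θ ℓ ⊆ dyadicArc β j m := by
  obtain ⟨m, hm, heq⟩ := exists_dyadicArc_eq β j ⌊(θ - β) * 2 ^ j⌋
  have hN : (0 : ℝ) < 2 ^ j := by positivity
  refine ⟨m, hm, heq ▸ arcSet_subset_arcSet ?_ ?_⟩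
  · have := (div_le_iff₀ hN).2 (Int.floor_le ((θ - β) * 2 ^ j))
    linarith
  · have := (le_div_iff₀ hN).2 h
    rw [add_div] at this
    linarith

/-- Lemma 2.8 (Mei): every arc `J` of the unit circle is contained in an arc `L` of one of
the two dyadic grids `D^0`, `D^{1/3}` with `|L| ≤ 6 |J|`. -/
theorem arc_subset_dyadic (θ ℓ : ℝ) (hℓ : ℓ ∈ Set.Ioc (0:ℝ) 1) :
    ∃ β ∈ ({0, 1/3} : Set ℝ), ∃ j m : ℕ, m < 2 ^ j ∧
      arcSet θ ℓ ⊆ dyadicArc β j m ∧ 1 / (2:ℝ) ^ j ≤ 6 * ℓ := by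
  obtain ⟨hpos, -⟩ := hℓ
  rcases lt_or_ge (1 / 3) ℓ with hlarge | hsmall
  · exact ⟨0, by simp, 0, 0, by simp,
      by simpa [dyadicArc] using arcSet_subset_arcSet_zero_one θ ℓ, by norm_num; linarith⟩
  obtain ⟨j, hj₁, hj₂⟩ := exists_nat_pow_near (x := 1 / (3 * ℓ)) (y := (2 : ℝ))
    (by rw [le_div_iff₀ (by positivity)]; linarith) (by norm_num)
  have hN : (0 : ℝ) < 2 ^ j := by positivity
  rw [le_div_iff₀ (by positivity)] at hj₁
  rw [div_lt_iff₀ (by positivity), pow_succ] at hj₂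
  have hlen : 1 / (2 : ℝ) ^ j ≤ 6 * ℓ := by
    rw [div_le_iff₀ hN]
    linarith
  by_cases h₀ : (θ + ℓ - 0) * 2 ^ j ≤ ⌊(θ - 0) * 2 ^ j⌋ + 1
  · obtain ⟨m, hm, hsub⟩ := arcSet_subset_floor h₀
    exact ⟨0, by simp, j, m, hm, hsub, hlen⟩
  by_cases h₁ : (θ + ℓ - 1 / 3) * 2 ^ j ≤ ⌊(θ - 1 / 3) * 2 ^ j⌋ + 1
  · obtain ⟨m, hm, hsub⟩ := arcSet_subset_floor h₁
    exact ⟨1 / 3, by simp, j, m, hm, hsub, hlen⟩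
  exfalso
  have hk := Int.lt_floor_add_one ((θ - 0) * 2 ^ j)
  have hp := Int.lt_floor_add_one ((θ - 1 / 3) * 2 ^ j)
  have hgap := one_le_abs_three_mul_sub_two_pow (⌊(θ - 0) * 2 ^ j⌋ - ⌊(θ - 1 / 3) * 2 ^ j⌋) j
  push_cast at hgap
  refine hgap.not_gt (abs_lt.2 ⟨?_, ?_⟩) <;> linarith
end
end

section
/- For all z, w ∈ 𝔻 with z·conj(w) ≠ 0, the function u ↦ 1/((1 − z·conj(u))·(1 − u·conj(w))) is integrable on 𝔻 with respect to planar Lebesgue measure dA, and ∫_𝔻 1/((1 − z·conj(u))(1 − u·conj(w))) dA(u) = π · (1/(z·conj(w))) · log(1/(1 − z·conj(w))), where log denotes the principal branch of the complex logarithm (note Re(1 − z·conj(w)) > 0). -/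
open MeasureTheory Metric Set
open scoped ENNReal Real

noncomputable section

/-- Integration in polar coordinates over a disk centred at the origin. -/
theorem setIntegral_ball_eq_integral_circleAverage {E : Type*} [NormedAddCommGroup E]
    [NormedSpace ℝ E] {f : ℂ → E} {R : ℝ} (hR : 0 ≤ R)
    (hf : ContinuousOn f (closedBall 0 R)) :
    ∫ u in ball (0 : ℂ) R, f u = ∫ r in (0 : ℝ)..R, (2 * π * r) • Real.circleAverage f 0 r := by
  have symm_eq (p : ℝ × ℝ) : Complex.polarCoord.symm p = circleMap 0 p.1 p.2 := by
    simp [circleMap_zero, Complex.exp_mul_I]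
  have hcont : ContinuousOn (fun p : ℝ × ℝ => p.1 • f (circleMap 0 p.1 p.2))
      (Icc 0 R ×ˢ Icc (-π) π) := by
    refine continuousOn_fst.smul (hf.comp (by unfold circleMap; fun_prop) ?_)
    rintro ⟨r, θ⟩ ⟨⟨hr0, hrR⟩, -⟩
    simpa [abs_of_nonneg hr0] using hrR
  have hint : IntegrableOn (fun p : ℝ × ℝ => p.1 • f (circleMap 0 p.1 p.2))
      (Ioo 0 R ×ˢ Ioo (-π) π) :=
    (hcont.integrableOn_compact (isCompact_Icc.prod isCompact_Icc)).mono_set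
      (prod_mono Ioo_subset_Icc_self Ioo_subset_Icc_self)
  have angular (r : ℝ) : ∫ θ in Ioo (-π) π, r • f (circleMap 0 r θ) =
      (2 * π * r) • Real.circleAverage f 0 r := by
    have hper : Function.Periodic (fun θ => f (circleMap 0 r θ)) (2 * π) := fun θ => by
      simp [periodic_circleMap 0 r θ]
    have hshift := hper.intervalIntegral_add_eq (-π) 0
    rw [show -π + 2 * π = π by ring, zero_add] at hshift
    rw [integral_smul, ← integral_Ioc_eq_integral_Ioo,
      ← intervalIntegral.integral_of_le (by linarith [Real.pi_pos]), hshift,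
      Real.circleAverage_def, smul_smul]
    congr 1
    field_simp
  calc ∫ u in ball (0 : ℂ) R, f u
      = ∫ p in polarCoord.target,
          p.1 • (ball (0 : ℂ) R).indicator f (Complex.polarCoord.symm p) := by
        rw [Complex.integral_comp_polarCoord_symm, integral_indicator measurableSet_ball]
    _ = ∫ p in polarCoord.target, (Ioo 0 R ×ˢ Ioo (-π) π).indicator
          (fun p : ℝ × ℝ => p.1 • f (circleMap 0 p.1 p.2)) p := by
        refine setIntegral_congr_fun polarCoord.open_target.measurableSet ?_
        rintro ⟨r, θ⟩ ⟨hr, hθ⟩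
        have hr : 0 < r := hr
        have hθ : θ ∈ Ioo (-π) π := hθ
        by_cases h : r < R <;> simp [symm_eq, indicator, abs_of_pos hr, hr, h, hθ.1, hθ.2]
    _ = ∫ p in Ioo 0 R ×ˢ Ioo (-π) π, p.1 • f (circleMap 0 p.1 p.2) := by
        rw [setIntegral_indicator (measurableSet_Ioo.prod measurableSet_Ioo),
          show polarCoord.target ∩ Ioo 0 R ×ˢ Ioo (-π) π = Ioo 0 R ×ˢ Ioo (-π) π from
            inter_eq_right.mpr (prod_mono Ioo_subset_Ioi_self Subset.rfl)]
    _ = ∫ r in Ioo 0 R, (2 * π * r) • Real.circleAverage f 0 r := by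
        rw [Measure.volume_eq_prod, setIntegral_prod _ hint]
        simp only [angular]
    _ = ∫ r in (0 : ℝ)..R, (2 * π * r) • Real.circleAverage f 0 r := by
        rw [intervalIntegral.integral_of_le hR, integral_Ioc_eq_integral_Ioo]

theorem one_sub_mul_ne_zero_of_norm {a b : ℂ} (ha : ‖a‖ < 1) (hb : ‖b‖ ≤ 1) : 1 - a * b ≠ 0 := by
  intro h
  have hab : ‖a * b‖ = 1 := by rw [← sub_eq_zero.mp h, norm_one]
  rw [norm_mul] at hab
  nlinarith [norm_nonneg a, norm_nonneg b]

/-- The circular means of a product of two Szegő kernels. -/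
theorem circleAverage_szego_mul_szego {z v : ℂ} (hz : ‖z‖ < 1) (hv : ‖v‖ < 1) {r : ℝ}
    (hr0 : 0 < r) (hr1 : r ≤ 1) :
    Real.circleAverage (fun u => 1 / ((1 - z * (starRingEnd ℂ) u) * (1 - u * v))) 0 r =
      1 / (1 - z * v * r ^ 2) := by
  have hball : z * r ^ 2 ∈ ball (0 : ℂ) |r| := by
    simp only [mem_ball_zero_iff, norm_mul, norm_pow, Complex.norm_real, Real.norm_eq_abs,
      abs_of_pos hr0]
    nlinarith [norm_nonneg z, mul_pos hr0 hr0]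
  have hdiff : DiffContOnCl ℂ (fun u : ℂ => 1 / (1 - u * v)) (ball 0 |r|) := by
    refine DifferentiableOn.diffContOnCl fun u hu => ?_
    have hu : ‖u‖ ≤ r := by
      simpa [abs_of_pos hr0] using closure_ball_subset_closedBall hu
    have hne := one_sub_mul_ne_zero_of_norm hv (hu.trans hr1)
    rw [mul_comm] at hne
    exact DifferentiableAt.differentiableWithinAt (by fun_prop (disch := assumption))
  have key := hdiff.circleAverage_smul_div hball
  rw [show z * v * (r : ℂ) ^ 2 = z * r ^ 2 * v by ring, ← key]
  refine Real.circleAverage_congr_sphere fun u hu => ?_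
  have hu : ‖u‖ = r := by simpa [abs_of_pos hr0] using hu
  have hu0 : u ≠ 0 := norm_pos_iff.mp (hu ▸ hr0)
  have hconj : u * (starRingEnd ℂ) u = r ^ 2 := by rw [Complex.mul_conj', hu]
  have hne := one_sub_mul_ne_zero_of_norm hz (b := (starRingEnd ℂ) u) (by simpa [hu] using hr1)
  have hfactor : u - z * r ^ 2 = u * (1 - z * (starRingEnd ℂ) u) := by rw [← hconj]; ring
  simp only [sub_zero, smul_eq_mul, hfactor]
  field_simp

theorem integral_two_pi_mul_div_one_sub_mul_sq {a : ℂ} (ha0 : a ≠ 0) (ha : ‖a‖ < 1) :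
    ∫ r in (0 : ℝ)..1, (2 * π * r) • (1 / (1 - a * (r : ℂ) ^ 2)) =
      π * a⁻¹ * Complex.log (1 / (1 - a)) := by
  have hslit {r : ℝ} (hr : r ∈ uIcc (0 : ℝ) 1) : 1 - a * (r : ℂ) ^ 2 ∈ Complex.slitPlane := by
    rw [uIcc_of_le zero_le_one] at hr
    rw [sub_eq_add_neg]
    refine Complex.mem_slitPlane_of_norm_lt_one ?_
    have hr2 : r ^ 2 ≤ 1 := pow_le_one₀ hr.1 hr.2
    simp only [norm_neg, norm_mul, norm_pow, Complex.norm_real, Real.norm_eq_abs, sq_abs]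
    nlinarith [norm_nonneg a]
  have hderiv (r : ℝ) (hr : r ∈ uIcc (0 : ℝ) 1) :
      HasDerivAt (fun r : ℝ => -(π * a⁻¹) * Complex.log (1 - a * (r : ℂ) ^ 2))
        ((2 * π * r) • (1 / (1 - a * (r : ℂ) ^ 2))) r := by
    have hinner : HasDerivAt (fun r : ℝ => 1 - a * (r : ℂ) ^ 2) (-(a * (2 * r))) r := by
      simpa using (((hasDerivAt_id r).ofReal_comp.pow 2).const_mul a).const_sub 1
    convert! (hinner.clog_real (hslit hr)).const_mul (-(π * a⁻¹)) using 1
    have hne := Complex.slitPlane_ne_zero (hslit hr)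
    rw [Complex.real_smul]
    push_cast
    field_simp
  have hcont : ContinuousOn (fun r : ℝ => (2 * π * r) • (1 / (1 - a * (r : ℂ) ^ 2)))
      (uIcc 0 1) := by
    have hinv : ContinuousOn (fun r : ℝ => 1 / (1 - a * (r : ℂ) ^ 2)) (uIcc 0 1) :=
      ContinuousOn.div (by fun_prop) (by fun_prop)
        fun r hr => Complex.slitPlane_ne_zero (hslit hr)
    exact ContinuousOn.smul (f := fun r : ℝ => 2 * π * r) (by fun_prop) hinv
  rw [intervalIntegral.integral_eq_sub_of_hasDerivAt hderiv hcont.intervalIntegrable]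
  have h1 : 1 - a ∈ Complex.slitPlane := by simpa using hslit (r := 1) (by simp)
  rw [one_div, Complex.log_inv _ (Complex.mem_slitPlane_iff_arg.mp h1).1]
  simp

/-- The explicit factorization of the Dirichlet reproducing kernel: for `z, w` in the unit
disk with `z conj(w) ≠ 0`,
`∫_𝔻 dA(u) / ((1 - z conj(u))(1 - u conj(w))) = π (z conj(w))⁻¹ log(1/(1 - z conj(w)))`,
and the integrand is absolutely integrable on the disk. -/
theorem integral_dirichlet_kernel_factorization (z w : ℂ)
    (hz : z ∈ Metric.ball (0:ℂ) 1) (hw : w ∈ Metric.ball (0:ℂ) 1)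
    (hzw : z * (starRingEnd ℂ) w ≠ 0) :
    IntegrableOn
      (fun u => 1 / ((1 - z * (starRingEnd ℂ) u) * (1 - u * (starRingEnd ℂ) w)))
      (Metric.ball 0 1) volume ∧
    ∫ u in Metric.ball (0:ℂ) 1,
        1 / ((1 - z * (starRingEnd ℂ) u) * (1 - u * (starRingEnd ℂ) w)) =
      (Real.pi : ℂ) * (z * (starRingEnd ℂ) w)⁻¹ *
        Complex.log (1 / (1 - z * (starRingEnd ℂ) w)) := by
  rw [mem_ball_zero_iff] at hz hw
  have hw' : ‖(starRingEnd ℂ) w‖ < 1 := by simpa using hw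
  have hcont : ContinuousOn
      (fun u => 1 / ((1 - z * (starRingEnd ℂ) u) * (1 - u * (starRingEnd ℂ) w)))
      (closedBall 0 1) := by
    refine ContinuousOn.div (by fun_prop) (by fun_prop) fun u hu => ?_
    have hu : ‖u‖ ≤ 1 := by simpa using hu
    refine mul_ne_zero (one_sub_mul_ne_zero_of_norm hz (by simpa using hu)) ?_
    rw [mul_comm]
    exact one_sub_mul_ne_zero_of_norm hw' hu
  refine ⟨(hcont.integrableOn_compact (isCompact_closedBall 0 1)).mono_set
    ball_subset_closedBall, ?_⟩
  have hnorm : ‖z * (starRingEnd ℂ) w‖ < 1 := by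
    rw [norm_mul]
    exact mul_lt_one_of_nonneg_of_lt_one_left (norm_nonneg z) hz hw'.le
  rw [setIntegral_ball_eq_integral_circleAverage zero_le_one hcont,
    ← integral_two_pi_mul_div_one_sub_mul_sq hzw hnorm,
    intervalIntegral.integral_of_le zero_le_one, intervalIntegral.integral_of_le zero_le_one]
  refine setIntegral_congr_fun measurableSet_Ioc fun r hr => ?_
  simp only [circleAverage_szego_mul_szego hz hw' hr.1 hr.2]
end
end
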